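/- For all n > 1 and 1 < k ≤ C(n−1, ⌊(n−1)/2⌋), every NGBW accepting the complement Σ_n^ω \ L(FB_{n,k}) has at least (n−1)! · ⌊k/2⌋^{n−1} states. -/

import Mathlib

namespace YanPaper

/-- A finite run, represented as the list of visited states, over a finite word. -/
def RunOn {S A : Type*} (Δ : S → A → S → Prop) : List S → List A → Prop
  | [_], [] => True
  | p :: q :: ρ, a :: w => Δ p a q ∧ RunOn Δ (q :: ρ) w
  | _, _ => False

/-- `p` reaches `q` via some finite run over the word `w`. -/
def Reaches {S A : Type*} (Δ : S → A → S → Prop) (p : S) (w : List A) (q : S) : Prop :=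
  ∃ ρ : List S, RunOn Δ ρ w ∧ ρ.head? = some p ∧ ρ.getLast? = some q

/-- `p` reaches `q` via some finite run over `w` that visits the set `T`. -/
def ReachesVisit {S A : Type*} (Δ : S → A → S → Prop) (T : Set S) (p : S) (w : List A)
    (q : S) : Prop :=
  ∃ ρ : List S, RunOn Δ ρ w ∧ ρ.head? = some p ∧ ρ.getLast? = some q ∧ ∃ s ∈ ρ, s ∈ T

/-- Nondeterministic finite word automaton. -/
structure NFW (A : Type*) (S : Type*) where
  I : Set S
  Δ : S → A → S → Prop
  F : Set S

def NFW.Lang {A S : Type*} (M : NFW A S) : Set (List A) :=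
  {w | ∃ p ∈ M.I, ∃ q ∈ M.F, Reaches M.Δ p w q}

/-- The full NFW over state set `S`: the alphabet is the set of all binary relations on `S`. -/
def FullNFW (S : Type*) (I F : Set S) : NFW (Set (S × S)) S where
  I := I
  Δ := fun p a q => (p, q) ∈ a
  F := F

/-- Minimal number of states of an NFW over alphabet `A` accepting the language `L`. -/
noncomputable def NFWminStates (A : Type*) (L : Set (List A)) : ℕ :=
  sInf {c : ℕ | ∃ C : NFW A (Fin c), C.Lang = L}

/-- A two letter alphabet. -/
inductive AB : Type
  | a : AB
  | b : AB

/-- States occurring infinitely often in an infinite run. -/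
def InfOcc {S : Type*} (ρ : ℕ → S) : Set S := {s | ∀ n : ℕ, ∃ m, n ≤ m ∧ ρ m = s}

/-- Nondeterministic Büchi word automaton. -/
structure NBW (A : Type*) (S : Type*) where
  I : Set S
  Δ : S → A → S → Prop
  F : Set S

def NBW.Lang {A S : Type*} (M : NBW A S) : Set (ℕ → A) :=
  {α | ∃ ρ : ℕ → S, ρ 0 ∈ M.I ∧ (∀ i, M.Δ (ρ i) (α i) (ρ (i + 1))) ∧
        (InfOcc ρ ∩ M.F).Nonempty}

/-- The full NBW over state set `S`. -/
def FullNBW (S : Type*) (I F : Set S) : NBW (Set (S × S)) S where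
  I := I
  Δ := fun p a q => (p, q) ∈ a
  F := F

/-- Minimal number of states of an NBW over alphabet `A` accepting the ω-language `L`. -/
noncomputable def NBWminStates (A : Type*) (L : Set (ℕ → A)) : ℕ :=
  sInf {c : ℕ | ∃ C : NBW A (Fin c), C.Lang = L}

/-- Vertex `(q, l)` of the Δ-graph of `α` is reachable from an initial vertex `(q_I, 0)`. -/
def GraphReach {A S : Type*} (M : NBW A S) (α : ℕ → A) (q : S) (l : ℕ) : Prop :=
  ∃ ρ : ℕ → S, ρ 0 ∈ M.I ∧ (∀ i, i < l → M.Δ (ρ i) (α i) (ρ (i + 1))) ∧ ρ l = q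

/-- A co-Büchi ranking for the Δ-graph of `α` under `M`, as a partial function
`S × ℕ → {0, …, 2n-2}` represented with `Option ℕ`. -/
def CRanking {A S : Type*} [Fintype S] (M : NBW A S) (α : ℕ → A)
    (f : S → ℕ → Option ℕ) : Prop :=
  (∀ q l r, f q l = some r → r ≤ 2 * Fintype.card S - 2) ∧
  (∀ q l, (f q l).isSome ↔ GraphReach M α q l) ∧
  (∀ q l r, f q l = some r → Odd r → q ∉ M.F) ∧
  (∀ q l q', M.Δ q (α l) q' → ∀ r r', f q l = some r → f q' (l + 1) = some r' → r' ≤ r)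

/-- The C-ranking `f` is odd: every infinite path of the Δ-graph starting at an initial
vertex has infinitely many odd-ranked vertices. -/
def OddCRanking {A S : Type*} [Fintype S] (M : NBW A S) (α : ℕ → A)
    (f : S → ℕ → Option ℕ) : Prop :=
  ∀ ρ : ℕ → S, ρ 0 ∈ M.I → (∀ i, M.Δ (ρ i) (α i) (ρ (i + 1))) →
    ∀ N : ℕ, ∃ l, N ≤ l ∧ ∃ r, f (ρ l) l = some r ∧ Odd r

/-- The state space of the full NBW `FB n`: `none` is the final state `s_f`, and
`some i` is the main state `s_i`. -/
abbrev FBState (n : ℕ) := Option (Fin (n - 1))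

/-- The alphabet of a full automaton with state space `FBState n`. -/
abbrev FBAlpha (n : ℕ) := Set (FBState n × FBState n)

/-- The full NBW `FB n`, with `n` states, main states initial and `s_f = none` final. -/
def FB (n : ℕ) : NBW (FBAlpha n) (FBState n) where
  I := {s | s ≠ none}
  Δ := fun p a q => (p, q) ∈ a
  F := {none}

/-- A `Q(m)`-ranking for `FB n`: a function on the main states with values in
`{0, …, 2m-1}` whose range contains all odd numbers in `{0, …, 2m-1}`. -/
def QRanking (n m : ℕ) (g : Fin (n - 1) → ℕ) : Prop :=
  (∀ q, g q < 2 * m) ∧ ∀ r, r < 2 * m → Odd r → ∃ q, g q = r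

/-- `w` is an `(f, g)`-segment for `FB n` (properties (P1), (P2), (P3)). -/
def IsSeg (n : ℕ) (f g : Fin (n - 1) → ℕ) (w : List (FBAlpha n)) : Prop :=
  w ≠ [] ∧
  (∀ p q : Fin (n - 1),
    Reaches (FB n).Δ (some p) w (some q) ↔ (g q < f p ∨ (f p = g q ∧ Odd (f p)))) ∧
  (∀ p q : Fin (n - 1),
    ReachesVisit (FB n).Δ {none} (some p) w (some q) ↔ g q < f p) ∧
  (∀ p q : FBState n, Reaches (FB n).Δ p w q → p ≠ none ∧ q ≠ none)

/-- `L(n, m)`: the number of `Q(m)`-rankings for `FB n`. -/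
noncomputable def Lnm (n m : ℕ) : ℕ := Nat.card {g : Fin (n - 1) → ℕ // QRanking n m g}

/-- `L(n) = max_{1 ≤ m < n} L(n, m)`. -/
noncomputable def Lmax (n : ℕ) : ℕ := (Finset.Ico 1 n).sup (fun m => Lnm n m)

/-- Nondeterministic Muller word automaton. -/
structure NMW (A : Type*) (S : Type*) where
  I : Set S
  Δ : S → A → S → Prop
  Acc : Set (Set S)

def NMW.Lang {A S : Type*} (M : NMW A S) : Set (ℕ → A) :=
  {α | ∃ ρ : ℕ → S, ρ 0 ∈ M.I ∧ (∀ i, M.Δ (ρ i) (α i) (ρ (i + 1))) ∧ InfOcc ρ ∈ M.Acc}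

/-- Nondeterministic generalized Büchi word automaton of index `k`. -/
structure NGBW (A : Type*) (S : Type*) where
  I : Set S
  Δ : S → A → S → Prop
  k : ℕ
  F : Fin k → Set S

def NGBW.Lang {A S : Type*} (M : NGBW A S) : Set (ℕ → A) :=
  {α | ∃ ρ : ℕ → S, ρ 0 ∈ M.I ∧ (∀ i, M.Δ (ρ i) (α i) (ρ (i + 1))) ∧
        ∀ i, (InfOcc ρ ∩ M.F i).Nonempty}

/-- Nondeterministic Streett word automaton of index `k`. -/
structure NSW (A : Type*) (S : Type*) where
  I : Set S
  Δ : S → A → S → Prop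
  k : ℕ
  acc : Fin k → Set S × Set S

def NSW.Lang {A S : Type*} (M : NSW A S) : Set (ℕ → A) :=
  {α | ∃ ρ : ℕ → S, ρ 0 ∈ M.I ∧ (∀ i, M.Δ (ρ i) (α i) (ρ (i + 1))) ∧
        ∀ i, (InfOcc ρ ∩ (M.acc i).2).Nonempty → (InfOcc ρ ∩ (M.acc i).1).Nonempty}

/-- Nondeterministic Rabin word automaton of index `k`. -/
structure NRW (A : Type*) (S : Type*) where
  I : Set S
  Δ : S → A → S → Prop
  k : ℕ
  acc : Fin k → Set S × Set S

def NRW.Lang {A S : Type*} (M : NRW A S) : Set (ℕ → A) :=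
  {α | ∃ ρ : ℕ → S, ρ 0 ∈ M.I ∧ (∀ i, M.Δ (ρ i) (α i) (ρ (i + 1))) ∧
        ∃ i, (InfOcc ρ ∩ (M.acc i).1).Nonempty ∧ InfOcc ρ ∩ (M.acc i).2 = ∅}

/-- The `k`-fold concatenation `w^k` of a finite word. -/
def listPow {A : Type*} (w : List A) (k : ℕ) : List A := (List.replicate k w).flatten

/-- `α` is the ω-word `u · v^ω`. -/
def IsUVOmega {A : Type*} (u v : List A) (α : ℕ → A) : Prop :=
  (∀ i (h : i < u.length), α i = u.get ⟨i, h⟩) ∧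
  (∀ i j (h : j < v.length), α (u.length + i * v.length + j) = v.get ⟨j, h⟩)

/-- A GC-segment of the NGBW `B`: a nonempty finite word `w` with `w^ω ∉ L(B)`. -/
def GCSeg {A S : Type*} (B : NGBW A S) (w : List A) : Prop :=
  w ≠ [] ∧ ∀ α, IsUVOmega [] w α → α ∉ B.Lang

/-- Two GC-segments conflict: every ω-word `w₁^{k₀} (w₁^{k₁} w₂^{k₂})^ω` is in `L(B)`. -/
def Conflict {A S : Type*} (B : NGBW A S) (w₁ w₂ : List A) : Prop :=
  ∀ k₀ k₁ k₂ : ℕ, 0 < k₀ → 0 < k₁ → 0 < k₂ →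
    ∀ α, IsUVOmega (listPow w₁ k₀) (listPow w₁ k₁ ++ listPow w₂ k₂) α → α ∈ B.Lang

/-- The full NGBW `FB (n,k)` with all states initial, distinguished state `s_nf = none`,
and acceptance sets `F i` (subsets of the main states). -/
def FBgen (n k : ℕ) (F : Fin k → Finset (Fin (n - 1))) :
    NGBW (FBAlpha n) (FBState n) where
  I := Set.univ
  Δ := fun p a q => (p, q) ∈ a
  k := k
  F := fun i => {s | ∃ q ∈ F i, s = some q}

/-- The conditions on the acceptance condition of `FB (n,k)`: the sets are pairwise
distinct, each of size `⌊(n-1)/2⌋`, and each main state avoids at least `⌊k/2⌋` sets. -/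
def GoodAcc (n k : ℕ) (F : Fin k → Finset (Fin (n - 1))) : Prop :=
  Function.Injective F ∧ (∀ i, (F i).card = (n - 1) / 2) ∧
  ∀ q : Fin (n - 1), k / 2 ≤ {i : Fin k | q ∉ F i}.ncard

/-- A PGCL-ranking for `FB (n,k)`: `f` is a bijection from the main states onto
`{1, …, n-1}` and `g` chooses for each main state `q` an index with `q ∉ F (g q)`. -/
def PGCL (n k : ℕ) (F : Fin k → Finset (Fin (n - 1)))
    (f : Fin (n - 1) → ℕ) (g : Fin (n - 1) → Fin k) : Prop :=
  (∀ p, 1 ≤ f p ∧ f p ≤ n - 1) ∧ Function.Injective f ∧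
  (∀ r, 1 ≤ r → r ≤ n - 1 → ∃ p, f p = r) ∧
  ∀ q, q ∉ F (g q)

/-- `ρ` is a finite run over `w` from `p` to `q`. -/
def RunFromTo {S A : Type*} (Δ : S → A → S → Prop) (w : List A) (p q : S)
    (ρ : List S) : Prop :=
  RunOn Δ ρ w ∧ ρ.head? = some p ∧ ρ.getLast? = some q

/-- `w` is an `⟨f, g⟩`-segment for `FB (n,k)` (properties (Q0)–(Q3)). -/
def IsSegGen (n k : ℕ) (F : Fin k → Finset (Fin (n - 1)))
    (f : Fin (n - 1) → ℕ) (g : Fin (n - 1) → Fin k)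
    (w : List (FBAlpha n)) : Prop :=
  w ≠ [] ∧
  -- (Q0) every finite run over `w` ends in a main state
  (∀ (ρ : List (FBState n)) (x : FBState n),
    RunOn (FBgen n k F).Δ ρ w → ρ.getLast? = some x → x ≠ none) ∧
  -- (Q1)
  (∀ p : Fin (n - 1),
    (∃! ρ, RunFromTo (FBgen n k F).Δ w (some p) (some p) ρ) ∧
    ∀ ρ, RunFromTo (FBgen n k F).Δ w (some p) (some p) ρ →
      (∀ i, i ≠ g p → ∃ s ∈ ρ, ∃ q ∈ F i, s = some q) ∧
      (∀ s ∈ ρ, ∀ q ∈ F (g p), s ≠ some q)) ∧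
  -- (Q2)
  (∀ p q : Fin (n - 1), f q < f p →
    (∃! ρ, RunFromTo (FBgen n k F).Δ w (some p) (some q) ρ) ∧
    ∀ ρ, RunFromTo (FBgen n k F).Δ w (some p) (some q) ρ →
      ∀ i, ∃ s ∈ ρ, ∃ r ∈ F i, s = some r) ∧
  -- (Q3)
  (∀ p q : Fin (n - 1), f p < f q →
    ¬∃ ρ, RunFromTo (FBgen n k F).Δ w (some p) (some q) ρ)

section Helpers

inductive Pth {S A : Type*} (Δ : S → A → S → Prop) : S → List A → Set S → S → Prop
  | nil (p : S) : Pth Δ p [] ∅ p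
  | cons {p r q : S} {a : A} {w : List A} {V : Set S} :
      Δ p a r → Pth Δ r w V q → Pth Δ p (a :: w) (insert p V) q

variable {S A : Type*} {Δ : S → A → S → Prop}

theorem Pth.nil_inv {p q : S} {V : Set S} (h : Pth Δ p [] V q) : p = q ∧ V = ∅ := by
  cases h; exact ⟨rfl, rfl⟩

theorem Pth.cons_inv {p q : S} {a : A} {w : List A} {V : Set S} (h : Pth Δ p (a :: w) V q) :
    ∃ r U, Δ p a r ∧ Pth Δ r w U q ∧ V = insert p U := by
  cases h with
  | cons h1 h2 => exact ⟨_, _, h1, h2, rfl⟩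

theorem Pth.append {p r q : S} {u v : List A} {V W : Set S} (h : Pth Δ p u V r)
    (h' : Pth Δ r v W q) : Pth Δ p (u ++ v) (V ∪ W) q := by
  induction h with
  | nil p => simpa using h'
  | cons h1 h2 ih =>
    rw [Set.insert_union]
    exact Pth.cons h1 (ih h')

theorem Pth.append_inv {p q : S} {u v : List A} {V : Set S} (h : Pth Δ p (u ++ v) V q) :
    ∃ r V1 V2, Pth Δ p u V1 r ∧ Pth Δ r v V2 q ∧ V = V1 ∪ V2 := by
  induction u generalizing p V with
  | nil => exact ⟨p, ∅, V, Pth.nil p, h, by simp⟩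
  | cons a u ih =>
    obtain ⟨r, U, h1, h2, rfl⟩ := Pth.cons_inv h
    obtain ⟨r', V1, V2, h3, h4, rfl⟩ := ih h2
    exact ⟨r', _, V2, Pth.cons h1 h3, h4, by rw [Set.insert_union]⟩

theorem listPow_zero (w : List A) : listPow w 0 = [] := rfl

theorem listPow_succ (w : List A) (k : ℕ) : listPow w (k + 1) = w ++ listPow w k := by
  simp [listPow, List.replicate_succ]

theorem Pth.pow {p q : S} {w : List A} {V U : Set S} (h : Pth Δ p w V q) (h' : Pth Δ q w U q)
    (k : ℕ) : ∃ V', V ⊆ V' ∧ Pth Δ p (listPow w (k + 1)) V' q := by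
  have idle : ∀ k, ∃ V', Pth Δ q (listPow w k) V' q := by
    intro k
    induction k with
    | zero => exact ⟨_, Pth.nil q⟩
    | succ k ih =>
      obtain ⟨V', hV⟩ := ih
      rw [listPow_succ]
      exact ⟨_, h'.append hV⟩
  obtain ⟨V', hV⟩ := idle k
  rw [listPow_succ]
  exact ⟨_, Set.subset_union_left, h.append hV⟩

/-- prepend a finite word to an infinite one -/
def wcat : List A → (ℕ → A) → ℕ → A
  | [], β => β
  | a :: u, β => fun i => Nat.casesOn i a (fun j => wcat u β j)

/-- the periodic word -/
def om (v : List A) (h : v ≠ []) (i : ℕ) : A :=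
  v[i % v.length]'(Nat.mod_lt _ (List.length_pos_iff.2 h))

theorem run_cat {p t : S} {u : List A} {V : Set S} (h : Pth Δ p u V t) (β : ℕ → A) (ρ : ℕ → S)
    (h0 : ρ 0 = t) (hρ : ∀ i, Δ (ρ i) (β i) (ρ (i + 1))) :
    ∃ ρ' : ℕ → S, ρ' 0 = p ∧ (∀ i, Δ (ρ' i) (wcat u β i) (ρ' (i + 1))) ∧
      InfOcc ρ ⊆ InfOcc ρ' := by
  induction h with
  | nil p => exact ⟨ρ, h0, hρ, le_rfl⟩
  | @cons p r q a w V h1 h2 ih =>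
    obtain ⟨ρ', h3, h4, h5⟩ := ih h0
    refine ⟨fun i => Nat.casesOn i p (fun j => ρ' j), rfl, ?_, ?_⟩
    · rintro (_ | i)
      · show Δ p a (ρ' 0)
        rw [h3]; exact h1
      · exact h4 i
    · intro s hs N
      obtain ⟨m, hm, hm'⟩ := h5 hs N
      exact ⟨m + 1, by omega, hm'⟩

theorem Pth.toFun {p q : S} {w : List A} {V : Set S} (h : Pth Δ p w V q) :
    ∃ σ : ℕ → S, σ 0 = p ∧ σ w.length = q ∧
      (∀ r (hr : r < w.length), Δ (σ r) (w[r]) (σ (r + 1))) ∧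
      ∀ x ∈ V, ∃ r, r < w.length ∧ σ r = x := by
  induction h with
  | nil p => exact ⟨fun _ => p, rfl, rfl, by simp, by simp⟩
  | @cons p r q a w V h1 h2 ih =>
    obtain ⟨σ, h3, h4, h5, h6⟩ := ih
    refine ⟨fun i => Nat.casesOn i p (fun j => σ j), rfl, h4, ?_, ?_⟩
    · rintro (_ | i) hi
      · show Δ p a (σ 0)
        rw [h3]; exact h1
      · exact h5 i (by simpa using hi)
    · rintro x (rfl | hx)
      · exact ⟨0, by simp, rfl⟩
      · obtain ⟨r, hr, hr'⟩ := h6 x hx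
        exact ⟨r + 1, by simpa using hr, hr'⟩

theorem run_om {t : S} {v : List A} (hv : v ≠ []) {V : Set S} (h : Pth Δ t v V t) :
    ∃ ρ : ℕ → S, ρ 0 = t ∧ (∀ i, Δ (ρ i) (om v hv i) (ρ (i + 1))) ∧ V ⊆ InfOcc ρ := by
  obtain ⟨σ, h0, hL, hs, hV⟩ := h.toFun
  have hpos : 0 < v.length := List.length_pos_iff.2 hv
  refine ⟨fun i => σ (i % v.length), by simpa using h0, ?_, ?_⟩
  · intro i
    have h1 := hs (i % v.length) (Nat.mod_lt _ hpos)
    have h2 : σ ((i + 1) % v.length) = σ (i % v.length + 1) := by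
      by_cases hc : i % v.length + 1 = v.length
      · have : (i + 1) % v.length = 0 := by
          rw [Nat.add_mod]
          by_cases h1 : v.length = 1
          · rw [h1]; omega
          · rw [Nat.mod_eq_of_lt (a := 1) (by omega), hc, Nat.mod_self]
        rw [this, hc, h0, hL]
      · have hlt := Nat.mod_lt i hpos
        have : (i + 1) % v.length = i % v.length + 1 := by
          rw [Nat.add_mod, Nat.mod_eq_of_lt (a := 1) (by omega), Nat.mod_eq_of_lt (by omega)]
        rw [this]
    show Δ (σ (i % v.length)) _ (σ ((i + 1) % v.length))
    rw [h2]
    exact h1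
  · intro x hx N
    obtain ⟨r, hr, hr'⟩ := hV x hx
    refine ⟨v.length * N + r, ?_, ?_⟩
    · have : 1 * N ≤ v.length * N := Nat.mul_le_mul_right _ hpos
      omega
    · show σ ((v.length * N + r) % v.length) = x
      rw [Nat.mul_add_mod, Nat.mod_eq_of_lt hr, hr']

theorem run_seg {α : ℕ → A} {ρ : ℕ → S} (hρ : ∀ i, Δ (ρ i) (α i) (ρ (i + 1))) (w : List A) (a : ℕ)
    (hw : ∀ r (hr : r < w.length), α (a + r) = w[r]) :
    Pth Δ (ρ a) w {x | ∃ r, r < w.length ∧ ρ (a + r) = x} (ρ (a + w.length)) := by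
  induction w generalizing a with
  | nil =>
    convert Pth.nil (Δ := Δ) (ρ a) using 1
    · ext; simp
    · rfl
  | cons b w ih =>
    have h1 := ih (a + 1) (fun r hr => by
      have := hw (r + 1) (by simpa using hr)
      rw [show a + 1 + r = a + (r + 1) by ring, this]; rfl)
    have h2 := hρ a
    have h3 : α a = b := hw 0 (by simp)
    rw [h3] at h2
    have h4 := Pth.cons h2 h1
    rw [show a + 1 + w.length = a + (b :: w).length by simp; ring] at h4
    convert h4 using 1
    ext x
    simp only [Set.mem_ofPred_eq, Set.mem_insert_iff, List.length_cons]
    constructor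
    · rintro ⟨_ | r, hr, rfl⟩
      · left; rfl
      · right; exact ⟨r, by omega, by congr 1; omega⟩
    · rintro (rfl | ⟨r, hr, rfl⟩)
      · exact ⟨0, by omega, rfl⟩
      · exact ⟨r + 1, by omega, by congr 1; omega⟩

theorem run_om_block {w : List A} (hw : w ≠ []) {ρ : ℕ → S}
    (hρ : ∀ i, Δ (ρ i) (om w hw i) (ρ (i + 1))) (j : ℕ) :
    Pth Δ (ρ (j * w.length)) w {x | ∃ r, r < w.length ∧ ρ (j * w.length + r) = x}
      (ρ ((j + 1) * w.length)) := by
  have := run_seg hρ w (j * w.length) (fun r hr => by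
    simp only [om]
    congr 1
    rw [mul_comm, Nat.mul_add_mod, Nat.mod_eq_of_lt hr])
  rwa [← Nat.succ_mul] at this

theorem run_om_blocks {w : List A} (hw : w ≠ []) {ρ : ℕ → S}
    (hρ : ∀ i, Δ (ρ i) (om w hw i) (ρ (i + 1))) (d j : ℕ) :
    ∃ V, Pth Δ (ρ (j * w.length)) (listPow w d) V (ρ ((j + d) * w.length)) ∧
      ∀ i, j * w.length ≤ i → i < (j + d) * w.length → ρ i ∈ V := by
  induction d generalizing j with
  | zero => exact ⟨_, Pth.nil _, fun i h1 h2 => by simp at h2; omega⟩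
  | succ d ih =>
    obtain ⟨V, h1, h2⟩ := ih (j + 1)
    rw [listPow_succ]
    refine ⟨{x | ∃ r, r < w.length ∧ ρ (j * w.length + r) = x} ∪ V, ?_, ?_⟩
    · rw [show j + (d + 1) = j + 1 + d by ring]
      exact (run_om_block hw hρ j).append h1
    · intro i hi1 hi2
      by_cases hc : (j + 1) * w.length ≤ i
      · right; exact h2 i hc (by rwa [show j + 1 + d = j + (d + 1) by ring])
      · left
        refine ⟨i - j * w.length, ?_, ?_⟩
        · rw [Nat.succ_mul] at hc; omega
        · congr 1; omega

/-- the pigeonhole decomposition of an accepting run on a periodic word -/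
theorem lasso {T : Type} [Fintype T] (C : NGBW A T) (w : List A) (hw : w ≠ [])
    (h : om w hw ∈ C.Lang) :
    ∃ t : T, ∃ q0 ∈ C.I, ∃ (a b : ℕ) (V0 V : Set T), Pth C.Δ q0 (listPow w a) V0 t ∧
      Pth C.Δ t (listPow w (b + 1)) V t ∧ ∀ i, (V ∩ C.F i).Nonempty := by
  obtain ⟨ρ, h0, hρ, hacc⟩ := h
  have hpos : 0 < w.length := List.length_pos_iff.2 hw
  obtain ⟨t, ht⟩ := Finite.exists_infinite_fiber (fun j : ℕ => ρ (j * w.length))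
  rw [Set.infinite_coe_iff] at ht
  obtain ⟨a, ha, -⟩ := ht.exists_gt 0
  choose s hs using hacc
  have : ∀ i, ∃ m, a * w.length ≤ m ∧ ρ m = s i := fun i => (hs i).1 _
  choose m hm1 hm2 using this
  obtain ⟨c, hc, hc'⟩ := ht.exists_gt (a + Finset.univ.sup m)
  obtain ⟨V0, hV0, -⟩ := run_om_blocks hw hρ a 0
  obtain ⟨V, hV, hV'⟩ := run_om_blocks hw hρ (c - a - 1 + 1) a
  have e : a + (c - a - 1 + 1) = c := by omega
  rw [e] at hV hV'
  simp only [Set.mem_preimage, Set.mem_singleton_iff] at ha hc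
  refine ⟨t, ρ 0, h0, a, c - a - 1, V0, V, ?_, ?_, ?_⟩
  · simpa [ha] using hV0
  · rw [ha, hc] at hV; exact hV
  · intro i
    refine ⟨s i, ?_, (hs i).2⟩
    rw [← hm2 i]
    apply hV' _ (hm1 i)
    have h1 : m i ≤ Finset.univ.sup m := Finset.le_sup (Finset.mem_univ i)
    have h2 : c * 1 ≤ c * w.length := Nat.mul_le_mul_left _ hpos
    omega

theorem lasso_mem {T : Type*} (C : NGBW A T) {q0 t : T} (h0 : q0 ∈ C.I) {u v : List A}
    (hv : v ≠ []) {V0 V : Set T} (h1 : Pth C.Δ q0 u V0 t) (h2 : Pth C.Δ t v V t)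
    (h3 : ∀ i, (V ∩ C.F i).Nonempty) : wcat u (om v hv) ∈ C.Lang := by
  obtain ⟨ρ, hρ0, hρ, hV⟩ := run_om hv h2
  obtain ⟨ρ', hρ0', hρ', hV'⟩ := run_cat h1 _ ρ hρ0 hρ
  refine ⟨ρ', hρ0' ▸ h0, hρ', fun i => ?_⟩
  obtain ⟨x, hx1, hx2⟩ := h3 i
  exact ⟨x, hV' (hV hx1), hx2⟩

end Helpers

section Gadgets

variable {M : Type*}

/-- transition relation of a full automaton -/
abbrev fullD (S : Type*) : S → Set (S × S) → S → Prop := fun p a q => (p, q) ∈ a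

/-- identity on main states -/
def idm (M : Type*) : Set (Option M × Option M) := {z | ∃ y : M, z = (some y, some y)}

/-- swap `none` with `some x` -/
def sw (x : M) : Set (Option M × Option M) :=
  {z | z = (none, some x) ∨ z = (some x, none) ∨ ∃ y, y ≠ x ∧ z = (some y, some y)}

def mid : List M → List (Set (Option M × Option M))
  | [] => []
  | x :: l => sw x :: sw x :: mid l

def J (p q : M) (X : List M) : List (Set (Option M × Option M)) :=
  insert (some p, none) (idm M) :: (mid X ++ [insert (none, some q) (idm M)])

theorem sw_two {x : M} {y z r : Option M} (h1 : (y, r) ∈ sw x) (h2 : (r, z) ∈ sw x) :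
    z = y ∧ (y ≠ none → r = y ∨ r = none) ∧ (y = none → r = some x) := by
  simp only [sw, Set.mem_ofPred_eq, Prod.mk.injEq] at h1 h2
  grind

theorem mid_inv {X : List M} {y z : Option M} {V : Set (Option M)}
    (h : Pth (fullD _) y (mid X) V z) :
    z = y ∧ (y ≠ none → V ⊆ {y, none}) ∧ (y = none → V ⊆ {v | v = none ∨ ∃ x ∈ X, v = some x}) := by
  induction X generalizing V y with
  | nil =>
    obtain ⟨rfl, rfl⟩ := h.nil_inv
    simp
  | cons x X ih =>
    obtain ⟨r, U, h1, h2, rfl⟩ := h.cons_inv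
    obtain ⟨r', U', h3, h4, rfl⟩ := h2.cons_inv
    obtain ⟨rfl, h5, h6⟩ := sw_two h1 h3
    obtain ⟨rfl, h7, h8⟩ := ih h4
    refine ⟨rfl, ?_, ?_⟩
    · intro hy v hv
      rcases hv with rfl | rfl | hv
      · simp
      · simpa using h5 hy
      · exact h7 hy hv
    · intro hy v hv
      rcases hv with rfl | rfl | hv
      · simp [hy]
      · right; exact ⟨x, by simp, h6 hy⟩
      · rcases h8 hy hv with h | ⟨x', hx', h⟩
        · exact Or.inl h
        · exact Or.inr ⟨x', by simp [hx'], h⟩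

theorem mid_ex (X : List M) (y : Option M) :
    ∃ V, Pth (fullD _) y (mid X) V y ∧ (y = none → ∀ x ∈ X, some x ∈ V) := by
  classical
  induction X with
  | nil => exact ⟨_, Pth.nil y, by simp⟩
  | cons x X ih =>
    obtain ⟨V, hV, hX⟩ := ih
    have : ∃ r, (y, r) ∈ sw x ∧ (r, y) ∈ sw x ∧ (y = none → r = some x) := by
      rcases y with _ | y
      · exact ⟨some x, by simp [sw]⟩
      · by_cases hy : y = x
        · subst hy; exact ⟨none, by simp [sw]⟩
        · exact ⟨some y, by simp [sw, hy]⟩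
    obtain ⟨r, h1, h2, h3⟩ := this
    refine ⟨_, Pth.cons (Δ := fullD _) h1 (Pth.cons (Δ := fullD _) h2 hV), ?_⟩
    intro hy x' hx'
    rcases List.mem_cons.1 hx' with rfl | hx'
    · right; left; exact (h3 hy).symm
    · right; right; exact hX hy x' hx'

theorem J_inv {p q : M} {X : List M} {y : M} {z : Option M} {V : Set (Option M)}
    (h : Pth (fullD _) (some y) (J p q X) V z) :
    (z = some y ∧ V ⊆ {some y, none}) ∨
    (y = p ∧ z = some q ∧ V ⊆ {v | v = none ∨ v = some p ∨ ∃ x ∈ X, v = some x}) := by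
  obtain ⟨r, U, h1, h2, rfl⟩ := h.cons_inv
  obtain ⟨s, U1, U2, h3, h4, rfl⟩ := h2.append_inv
  obtain ⟨t, U3, h5, h6, rfl⟩ := h4.cons_inv
  obtain ⟨rfl, rfl⟩ := h6.nil_inv
  obtain ⟨rfl, h7, h8⟩ := mid_inv h3
  simp only [fullD, idm, Set.mem_insert_iff, Prod.mk.injEq, Set.mem_ofPred_eq] at h1 h5
  rcases h1 with ⟨h1, rfl⟩ | ⟨y', h1, rfl⟩
  · right
    rcases h5 with ⟨-, rfl⟩ | ⟨y', h5, rfl⟩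
    · refine ⟨by simpa using h1, rfl, ?_⟩
      have := h8 rfl
      rintro v (rfl | hv | rfl | hv)
      · exact Or.inr (Or.inl h1)
      · rcases this hv with h | h
        · exact Or.inl h
        · exact Or.inr (Or.inr h)
      · exact Or.inl rfl
      · exact hv.elim
    · simp at h5
  · left
    rcases h5 with ⟨h5, -⟩ | ⟨y'', h5, rfl⟩
    · simp at h5
    · rw [← h5, ← h1] at *
      refine ⟨rfl, ?_⟩
      have := h7 (by simp)
      rintro v (rfl | hv | rfl | hv)
      · simp
      · exact this hv
      · simp
      · exact hv.elim

theorem J_idle (p q : M) (X : List M) (y : M) :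
    ∃ V, Pth (fullD _) (some y) (J p q X) V (some y) := by
  obtain ⟨V, hV, -⟩ := mid_ex X (some y)
  exact ⟨_, Pth.cons (Δ := fullD _) (r := some y) (by simp [fullD, idm])
    (hV.append (Pth.cons (Δ := fullD _) (r := some y) (by simp [fullD, idm]) (Pth.nil _)))⟩

theorem J_jump (p q : M) (X : List M) :
    ∃ V, Pth (fullD _) (some p) (J p q X) V (some q) ∧ ∀ x ∈ X, some x ∈ V := by
  obtain ⟨V, hV, h⟩ := mid_ex X none
  refine ⟨_, Pth.cons (Δ := fullD _) (r := none) (by simp [fullD, idm])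
    (hV.append (Pth.cons (Δ := fullD _) (r := some q) (by simp [fullD, idm]) (Pth.nil _))), ?_⟩
  intro x hx
  right; left; exact h rfl x hx

/-- concatenation of gadgets -/
def Js (X : M → M → List M) : List (M × M) → List (Set (Option M × Option M))
  | [] => []
  | pq :: l => J pq.1 pq.2 (X pq.1 pq.2) ++ Js X l

variable {m : ℕ}

theorem Js_inv (f : M → Fin m) (hf : Function.Injective f) (X : M → M → List M)
    (l : List (M × M)) (hl : ∀ pq ∈ l, f pq.2 ≤ f pq.1) {y : M} {z : Option M}
    {V : Set (Option M)} (h : Pth (fullD _) (some y) (Js X l) V z) :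
    ∃ q, z = some q ∧ f q ≤ f y ∧
      (q = y → V ⊆ {v | v = none ∨ v = some y ∨ ∃ x ∈ X y y, v = some x}) := by
  induction l generalizing y V with
  | nil =>
    obtain ⟨rfl, rfl⟩ := h.nil_inv
    exact ⟨y, rfl, le_rfl, by simp⟩
  | cons pq l ih =>
    obtain ⟨r, V1, V2, h1, h2, rfl⟩ := Pth.append_inv h
    have hpq := hl pq (by simp)
    have ih' := fun y V => @ih (fun pq h => hl pq (by simp [h])) y V
    rcases J_inv h1 with ⟨rfl, hV⟩ | ⟨rfl, rfl, hV⟩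
    · obtain ⟨q, rfl, hq, hq'⟩ := ih' _ _ h2
      refine ⟨q, rfl, hq, ?_⟩
      rintro rfl
      apply Set.union_subset _ (hq' rfl)
      intro v hv
      rcases hV hv with h | h
      · exact Or.inr (Or.inl h)
      · exact Or.inl h
    · obtain ⟨q, rfl, hq, hq'⟩ := ih' _ _ h2
      refine ⟨q, rfl, hq.trans hpq, ?_⟩
      rintro rfl
      have e : pq.1 = pq.2 := hf (le_antisymm hq hpq)
      rw [← e] at hV hq'
      exact Set.union_subset hV (hq' rfl)

theorem Js_idle (X : M → M → List M) (l : List (M × M)) (y : M) :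
    ∃ V, Pth (fullD _) (some y) (Js X l) V (some y) := by
  induction l with
  | nil => exact ⟨_, Pth.nil _⟩
  | cons pq l ih =>
    obtain ⟨V, hV⟩ := ih
    obtain ⟨U, hU⟩ := J_idle pq.1 pq.2 (X pq.1 pq.2) y
    exact ⟨_, hU.append hV⟩

theorem Js_jump (X : M → M → List M) (l : List (M × M)) (p q : M) (h : (p, q) ∈ l) :
    ∃ V, Pth (fullD _) (some p) (Js X l) V (some q) ∧ ∀ x ∈ X p q, some x ∈ V := by
  induction l with
  | nil => simp at h
  | cons pq l ih =>
    rcases List.mem_cons.1 h with rfl | h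
    · obtain ⟨V, hV⟩ := Js_idle X l q
      obtain ⟨U, hU, hx⟩ := J_jump p q (X p q)
      exact ⟨_, hU.append hV, fun x hx' => Or.inl (hx x hx')⟩
    · obtain ⟨V, hV, hx⟩ := ih h
      obtain ⟨U, hU⟩ := J_idle pq.1 pq.2 (X pq.1 pq.2) p
      exact ⟨_, hU.append hV, fun x hx' => Or.inr (hx x hx')⟩

open Classical in
/-- The word attached to a ranking `f` and forbidden sets `G`. -/
noncomputable def Wd (f : Fin m → Fin m) (G : Fin m → Finset (Fin m)) :
    List (Set (Option (Fin m) × Option (Fin m))) :=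
  idm (Fin m) :: Js (fun p q => (Finset.univ.filter (fun x => p = q → x ∉ G p)).toList)
    ((Finset.univ.filter (fun pq : Fin m × Fin m => f pq.2 ≤ f pq.1)).toList)

theorem Wd_ne (f : Fin m → Fin m) (G : Fin m → Finset (Fin m)) : Wd f G ≠ [] := by simp [Wd]

theorem Wd_inv (f : Fin m → Fin m) (hf : Function.Injective f) (G : Fin m → Finset (Fin m))
    (hG : ∀ p, p ∉ G p) {y z : Option (Fin m)} {V : Set (Option (Fin m))}
    (h : Pth (fullD _) y (Wd f G) V z) :
    ∃ p q, y = some p ∧ z = some q ∧ f q ≤ f p ∧ (q = p → ∀ x ∈ G p, some x ∉ V) := by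
  obtain ⟨r, U, h1, h2, rfl⟩ := h.cons_inv
  obtain ⟨p, hp⟩ := h1
  simp only [Prod.mk.injEq] at hp
  obtain ⟨rfl, rfl⟩ := hp
  obtain ⟨q, rfl, h3, h4⟩ := Js_inv f hf _ _ (by simp) h2
  refine ⟨p, q, rfl, rfl, h3, ?_⟩
  intro hq x hx hxV
  have hxp : x ≠ p := by rintro rfl; exact hG _ hx
  rcases hxV with h | h
  · exact hxp (by simpa using h)
  · rcases h4 hq h with h | h | ⟨x', hx', h⟩
    · simp at h
    · exact hxp (by simpa using h)
    · simp at h hx'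
      subst h
      exact hx' hx

theorem Wd_jump (f : Fin m → Fin m) (G : Fin m → Finset (Fin m)) (p q : Fin m) (h : f q ≤ f p) :
    ∃ V, Pth (fullD _) (some p) (Wd f G) V (some q) ∧ ∀ x, (p = q → x ∉ G p) → some x ∈ V := by
  classical
  obtain ⟨V, hV, hx⟩ := Js_jump
    (fun p q => (Finset.univ.filter (fun x => p = q → x ∉ G p)).toList)
    ((Finset.univ.filter (fun pq : Fin m × Fin m => f pq.2 ≤ f pq.1)).toList) p q (by simpa using h)
  refine ⟨insert (some p) V, ?_, ?_⟩
  · unfold Wd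
    convert Pth.cons (Δ := fullD _) (r := some p) (a := idm (Fin m)) ⟨p, rfl⟩ hV
  · intro x hx'
    right
    exact hx x (by simpa using hx')

/-- the periodic word is rejected -/
theorem Wd_reject (f : Fin m → Fin m) (hf : Function.Injective f) (G : Fin m → Finset (Fin m))
    (hG : ∀ p, p ∉ G p) (ρ : ℕ → Option (Fin m))
    (hρ : ∀ i, (ρ i, om (Wd f G) (Wd_ne f G) i) ∈ {z : Option (Fin m) × Set _ |
      (z.1, ρ (i + 1)) ∈ z.2}) :
    ∃ p, ∀ x ∈ G p, some x ∉ InfOcc ρ := by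
  set w := Wd f G with hw
  have hpos : 0 < w.length := List.length_pos_iff.2 (Wd_ne f G)
  have hb := fun j => Wd_inv f hf G hG
    (run_om_block (Δ := fullD _) (Wd_ne f G) (ρ := ρ) hρ j)
  choose P Q h1 h2 h3 h4 using hb
  have hPQ : ∀ j, Q j = P (j + 1) := by
    intro j
    have := (h2 j).symm.trans (h1 (j + 1))
    simpa using this
  have hmono : Antitone (fun j => f (P j)) := antitone_nat_of_succ_le (fun j => hPQ j ▸ h3 j)
  obtain ⟨_, ⟨j0, rfl⟩, hmin⟩ := Set.exists_min_image (Set.range (fun j => f (P j))) id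
    (Set.toFinite _) (Set.range_nonempty _)
  have hconst : ∀ j, j0 ≤ j → P j = P j0 := by
    intro j hj
    exact hf (le_antisymm (hmono hj) (hmin _ ⟨j, rfl⟩))
  refine ⟨P j0, ?_⟩
  intro x hx hinf
  obtain ⟨i, hi, hi'⟩ := hinf (j0 * w.length)
  have hj : j0 ≤ i / w.length := (Nat.le_div_iff_mul_le hpos).2 hi
  have e := hconst _ hj
  have e' := hconst _ (Nat.le_succ_of_le hj)
  refine h4 (i / w.length) (by rw [hPQ]; exact e'.trans e.symm) x (by rw [e]; exact hx) ?_
  exact ⟨i % w.length, Nat.mod_lt _ hpos, by rw [Nat.div_add_mod']; exact hi'⟩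

theorem perm_inversion {f f' : Equiv.Perm (Fin m)} (h : f ≠ f') :
    ∃ p q, f q < f p ∧ f' p < f' q := by
  by_contra hc
  push Not at hc
  apply h
  have hs : StrictMono (fun x => f' (f.symm x)) := by
    intro a b hab
    have := hc (f.symm b) (f.symm a) (by simpa using hab)
    exact lt_of_le_of_ne this (fun e => hab.ne (by simpa using e))
  have := (hs.range_inj strictMono_id).1 (by
    rw [show (fun x => f' (f.symm x)) = ⇑(f.symm.trans f') from rfl, Equiv.range_eq_univ]; simp)
  ext x
  have := congrFun this (f x)
  simp at this
  rw [this]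

end Gadgets

/-- Conflict of two different rankings. -/
theorem conflict_mem (n k : ℕ) (F : Fin k → Finset (Fin (n - 1))) (hk : 1 < k)
    (hdiff : ∀ i j, i ≠ j → ∃ x, x ∈ F i ∧ x ∉ F j)
    (f f' : Equiv.Perm (Fin (n - 1))) (g g' : Fin (n - 1) → Fin k)
    (hne : f ≠ f' ∨ g ≠ g') (a b b' : ℕ)
    (hv : listPow (Wd f (fun p => F (g p))) (b + 1) ++
      listPow (Wd f' (fun p => F (g' p))) (b' + 1) ≠ []) :
    wcat (listPow (Wd f (fun p => F (g p))) a) (om _ hv) ∈ (FBgen n k F).Lang := by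
  have main : ∃ p q, f q ≤ f p ∧ f' p ≤ f' q ∧ ∀ i, ∃ x ∈ F i,
      (p = q → x ∉ F (g p)) ∨ (q = p → x ∉ F (g' q)) := by
    by_cases hf : f = f'
    · subst hf
      have hg : g ≠ g' := by simpa using hne
      obtain ⟨p, hp⟩ := Function.ne_iff.1 hg
      refine ⟨p, p, le_rfl, le_rfl, fun i => ?_⟩
      by_cases hi : i = g p
      · obtain ⟨x, h1, h2⟩ := hdiff i (g' p) (hi ▸ hp)
        exact ⟨x, h1, Or.inr fun _ => h2⟩
      · obtain ⟨x, h1, h2⟩ := hdiff i (g p) hi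
        exact ⟨x, h1, Or.inl fun _ => h2⟩
    · obtain ⟨p, q, h1, h2⟩ := perm_inversion hf
      refine ⟨p, q, h1.le, h2.le, fun i => ?_⟩
      have : Nontrivial (Fin k) := Fin.nontrivial_iff_two_le.2 hk
      obtain ⟨j, hj⟩ := exists_ne i
      obtain ⟨x, h3, -⟩ := hdiff i j hj.symm
      refine ⟨x, h3, Or.inl fun e => ?_⟩
      subst e
      exact absurd h1 (lt_irrefl _)
  obtain ⟨p, q, h1, h2, h3⟩ := main
  obtain ⟨V, hV, hVx⟩ := Wd_jump f (fun p => F (g p)) p q h1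
  obtain ⟨V', hV', hVx'⟩ := Wd_jump f' (fun p => F (g' p)) q p h2
  obtain ⟨I1, hI1, -⟩ := Wd_jump f (fun p => F (g p)) p p le_rfl
  obtain ⟨I2, hI2, -⟩ := Wd_jump f (fun p => F (g p)) q q le_rfl
  obtain ⟨I3, hI3, -⟩ := Wd_jump f' (fun p => F (g' p)) p p le_rfl
  obtain ⟨U, hU, hU'⟩ := hV.pow hI2 b
  obtain ⟨U', hU1, hU1'⟩ := hV'.pow hI3 b'
  have h0 : ∃ V0, Pth (FBgen n k F).Δ (some p) (listPow (Wd f (fun p => F (g p))) a) V0 (some p) := by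
    rcases a with _ | a
    · exact ⟨_, Pth.nil _⟩
    · obtain ⟨V0, -, h⟩ := hI1.pow hI1 a
      exact ⟨V0, h⟩
  obtain ⟨V0, hV0⟩ := h0
  refine lasso_mem (FBgen n k F) (q0 := some p) trivial hv hV0 (V := U ∪ U') (hU'.append hU1') ?_
  intro i
  obtain ⟨x, hx, h | h⟩ := h3 i
  · exact ⟨some x, Or.inl (hU (hVx x h)), x, hx, rfl⟩
  · exact ⟨some x, Or.inr (hU1 (hVx' x h)), x, hx, rfl⟩

/-- every NGBW accepting the complement of `L(FB (n,k))` has at least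
`(n-1)! ⌊k/2⌋^{n-1}` states. -/
theorem generalized_buchi_complementation_lower_bound (n k : ℕ) (hn : 1 < n) (hk1 : 1 < k)
    (hk2 : k ≤ (n - 1).choose ((n - 1) / 2))
    (F : Fin k → Finset (Fin (n - 1))) (hF : GoodAcc n k F)
    (T : Type) [Fintype T] (C : NGBW (FBAlpha n) T)
    (hC : C.Lang = (FBgen n k F).Langᶜ) :
    (n - 1).factorial * (k / 2) ^ (n - 1) ≤ Fintype.card T := by
  classical
  obtain ⟨hinj, hcard, hav⟩ := hF
  have hdiff : ∀ i j, i ≠ j → ∃ x, x ∈ F i ∧ x ∉ F j := by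
    intro i j hij
    by_contra hc
    push Not at hc
    exact hij (hinj (Finset.eq_of_subset_of_card_le hc (by rw [hcard, hcard])))
  let R := Equiv.Perm (Fin (n - 1)) × ((q : Fin (n - 1)) → {i : Fin k // q ∉ F i})
  let w : R → List (FBAlpha n) := fun c => Wd c.1 (fun p => F (c.2 p).1)
  have hw : ∀ c, w c ≠ [] := fun c => Wd_ne _ _
  have hmem : ∀ c, om (w c) (hw c) ∈ C.Lang := by
    intro c
    rw [hC]
    rintro ⟨ρ, -, hρ, hacc⟩
    obtain ⟨p, hp⟩ := Wd_reject c.1 c.1.injective (fun p => F (c.2 p).1)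
      (fun p => (c.2 p).2) ρ hρ
    obtain ⟨s, hs, x, hx, rfl⟩ := hacc (c.2 p).1
    exact hp x hx hs
  choose t q0 hq0 a b V0 V h1 h2 h3 using fun c => lasso C (w c) (hw c) (hmem c)
  have tinj : Function.Injective t := by
    intro c c' hcc
    by_contra hne
    have hne' : c.1 ≠ c'.1 ∨ (fun p => (c.2 p).1) ≠ (fun p => (c'.2 p).1) := by
      by_contra hcon
      push Not at hcon
      apply hne
      refine Prod.ext hcon.1 ?_
      funext p
      exact Subtype.ext (congrFun hcon.2 p)
    have hv : listPow (w c) (b c + 1) ++ listPow (w c') (b c' + 1) ≠ [] := by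
      rw [listPow_succ]
      simp [hw c]
    have hB := conflict_mem n k F hk1 hdiff c.1 c'.1 (fun p => (c.2 p).1)
      (fun p => (c'.2 p).1) hne' (a c) (b c) (b c') hv
    have h2' := h2 c'
    rw [← hcc] at h2'
    have hA := lasso_mem C (hq0 c) hv (h1 c) ((h2 c).append h2') (fun i => by
      obtain ⟨x, hx, hx'⟩ := h3 c i
      exact ⟨x, Or.inl hx, hx'⟩)
    rw [hC] at hA
    exact hA hB
  refine le_trans ?_ (Fintype.card_le_of_injective t tinj)
  show _ ≤ Fintype.card (Equiv.Perm (Fin (n - 1)) × ((q : Fin (n - 1)) → {i : Fin k // q ∉ F i}))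
  rw [Fintype.card_prod, Fintype.card_perm, Fintype.card_fin, Fintype.card_pi]
  apply Nat.mul_le_mul_left
  calc (k / 2) ^ (n - 1) = ∏ _q : Fin (n - 1), (k / 2) := by simp
    _ ≤ _ := by
      apply Finset.prod_le_prod' 
      intro q _
      have := hav q
      rwa [← Nat.card_coe_set_eq, Nat.card_eq_fintype_card] at this

end YanPaper
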